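/- arXiv:2409.13352 — 3 statements merged into one kernel-verified Lean document; each statement's English description precedes it below -/
import Mathlib

section
/- Let n ≥ 1, r ≥ 1, let q_1 = x_0^2 + ⋯ + x_{n-2}^2 ∈ ℂ[x_0,…,x_{n-1}] and f_0 = Σ_{k=0}^{r} (r!/(r−k)!) · q_1^{r−k} · x_{n-1}^k. Then the ℂ-vector space spanned by all iterated partial derivatives ∂^α f_0, as α ranges over all multi-indices in ℕ^{n} (including α = 0), has dimension binom(n+r, n). (This is the length of the local tautological apolar scheme Γ_0 used to prove that the cactus rank of q^r equals binom(n+r,n).) -/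
open MvPolynomial

/-- Iterated partial derivative `∂^α f`: `MvPolynomial.pderiv i` is applied `α i` times
for each variable `i`. -/
noncomputable def pdPow {n : ℕ} (α : Fin n →₀ ℕ) (f : MvPolynomial (Fin n) ℂ) :
    MvPolynomial (Fin n) ℂ :=
  (List.finRange n).foldr (fun i g => (fun h => MvPolynomial.pderiv i h)^[α i] g) f

/-- `q_1 = x_0^2 + ⋯ + x_{n-2}^2` in `ℂ[x_0,…,x_{n-1}]`. -/
noncomputable def q1Form (n : ℕ) : MvPolynomial (Fin n) ℂ :=
  ∑ i ∈ Finset.univ.filter (fun i : Fin n => (i : ℕ) + 2 ≤ n), X i ^ 2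

/-- `f_0 = Σ_{k=0}^{r} (r!/(r−k)!) · q_1^{r−k} · x_{n-1}^k`. -/
noncomputable def tautF (n r : ℕ) (hn : 1 ≤ n) : MvPolynomial (Fin n) ℂ :=
  ∑ k ∈ Finset.range (r + 1),
    C ((r.factorial : ℂ) / ((r - k).factorial : ℂ)) *
      q1Form n ^ (r - k) * X (⟨n - 1, by omega⟩ : Fin n) ^ k


open Finset in
lemma psd_zero {ι κ : Type*} (A : Finset ι) (K : Finset κ) (D : κ → ℝ) (T : κ → ι → ℝ)
    (p : ι → ℂ) (hD : ∀ k ∈ K, 0 < D k)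
    (h : ∑ a ∈ A, ∑ a' ∈ A, p a * (starRingEnd ℂ) (p a') *
      ((∑ k ∈ K, D k * T k a * T k a' : ℝ) : ℂ) = 0) :
    ∀ k ∈ K, ∑ a ∈ A, p a * (T k a : ℂ) = 0 := by
  have key : ((∑ k ∈ K, D k * Complex.normSq (∑ a ∈ A, p a * (T k a : ℂ)) : ℝ) : ℂ) = 0 := by
    rw [← h]
    push_cast
    simp_rw [← Complex.mul_conj, map_sum, map_mul, Complex.conj_ofReal, Finset.sum_mul_sum,
      Finset.mul_sum]
    rw [Finset.sum_comm]
    refine Finset.sum_congr rfl fun a _ => ?_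
    rw [Finset.sum_comm]
    refine Finset.sum_congr rfl fun a' _ => ?_
    refine Finset.sum_congr rfl fun k _ => ?_
    ring
  have key2 := Complex.ofReal_eq_zero.mp key
  rw [Finset.sum_eq_zero_iff_of_nonneg
    (fun k hk => mul_nonneg (hD k hk).le (Complex.normSq_nonneg _))] at key2
  intro k hk
  have := key2 k hk
  rcases mul_eq_zero.mp this with h1 | h1
  · exact absurd h1 (hD k hk).ne'
  · exact Complex.normSq_eq_zero.mp h1

/-- Coefficients expressing powers in terms of Hermite polynomials. -/
noncomputable def cx (k a : ℕ) : ℝ :=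
  if k ≤ a ∧ Even (a - k) then (a.factorial : ℝ) / (k.factorial * ((a - k) / 2).factorial) else 0

noncomputable def dx (k : ℕ) : ℝ := 2 ^ k * k.factorial

lemma dx_pos (k : ℕ) : 0 < dx k := by unfold dx; positivity

lemma dx_succ (k : ℕ) : dx (k + 1) = 2 * (k + 1) * dx k := by
  unfold dx; rw [Nat.factorial_succ]; push_cast; ring

lemma cx_gt {k a : ℕ} (h : a < k) : cx k a = 0 := by
  unfold cx; rw [if_neg]; omega

lemma cx_eq (k e : ℕ) :
    cx k (k + 2 * e) = ((k + 2 * e).factorial : ℝ) / (k.factorial * e.factorial) := by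
  unfold cx
  have h1 : k + 2 * e - k = 2 * e := by omega
  rw [if_pos ⟨by omega, by rw [h1]; exact even_two_mul e⟩, h1]
  congr 4
  omega

lemma cx_odd {k a : ℕ} (h : ¬ Even (a + k)) : cx k a = 0 := by
  unfold cx
  rw [if_neg]
  rintro ⟨h1, h2⟩
  apply h
  rw [Nat.even_sub h1] at h2
  rw [Nat.even_add]; exact h2

lemma cx_zero_succ (a : ℕ) : cx 0 (a + 1) = 2 * cx 1 a := by
  by_cases h : Even (a + 1)
  · obtain ⟨e, he⟩ := h
    obtain ⟨e, rfl⟩ : ∃ e', e = e' + 1 := ⟨e - 1, by omega⟩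
    obtain rfl : a = 1 + 2 * e := by omega
    have h1 : 1 + 2 * e + 1 = 0 + 2 * (e + 1) := by ring
    rw [h1, cx_eq, cx_eq]
    have h2 : 0 + 2 * (e + 1) = (1 + 2 * e) + 1 := by ring
    rw [h2, Nat.factorial_succ (1 + 2 * e), Nat.factorial_succ e]
    have := Nat.factorial_pos e
    push_cast
    simp
    field_simp
    ring
  · rw [cx_odd (by simpa using h), cx_odd h]; simp

lemma cx_succ_succ (k a : ℕ) : cx (k + 1) (a + 1) = cx k a + 2 * (k + 2) * cx (k + 2) a := by
  by_cases h : Even (a + k)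
  · rcases lt_or_ge a k with hk | hk
    · rw [cx_gt (by omega), cx_gt hk, cx_gt (by omega)]; simp
    · obtain ⟨e, rfl⟩ : ∃ e, a = k + 2 * e := by
        obtain ⟨e, he⟩ := h
        exact ⟨e - k, by omega⟩
      rcases e with _ | e
      · have h1 : k + 2 * 0 + 1 = (k + 1) + 2 * 0 := by ring
        rw [cx_gt (k := k + 2) (by omega), h1, cx_eq, cx_eq]
        have := Nat.factorial_pos k
        have := Nat.factorial_pos (k + 1)
        simp
        field_simp
      · have h1 : k + 2 * (e + 1) + 1 = (k + 1) + 2 * (e + 1) := by ring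
        rw [h1, cx_eq, cx_eq]
        have h2 : k + 2 * (e + 1) = (k + 2) + 2 * e := by ring
        have h3 : (k + 1) + 2 * (e + 1) = ((k + 2) + 2 * e) + 1 := by ring
        rw [h3, h2, cx_eq, Nat.factorial_succ (k + 2 + 2 * e), Nat.factorial_succ e,
          Nat.factorial_succ (k + 1), Nat.factorial_succ k]
        have := Nat.factorial_pos e
        have := Nat.factorial_pos k
        push_cast
        field_simp
        ring
  · have h2 : ¬ Even (a + 1 + (k + 1)) := by
      intro h'; apply h; rw [Nat.even_iff] at *; omega
    have h3 : ¬ Even (a + (k + 2)) := by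
      intro h'; apply h; rw [Nat.even_iff] at *; omega
    rw [cx_odd h2, cx_odd h, cx_odd h3]; simp

lemma cx_zero_left_zero (k : ℕ) : cx k 0 = if k = 0 then 1 else 0 := by
  unfold cx
  rcases k with _ | k <;> simp

open Finset in
lemma sx_step (R a a' : ℕ) (ha : a ≤ R) :
    ∑ k ∈ range (R + 1), dx k * cx k (a + 1) * cx k a' =
    ∑ k ∈ range R, dx (k + 1) * (cx k a * cx (k + 1) a' + cx (k + 1) a * cx k a') := by
  have h2 : ∑ k ∈ range R, dx (k + 1) * (cx (k + 1) a * cx k a') =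
      ∑ k ∈ range (R + 1), dx (k + 1) * (cx (k + 1) a * cx k a') := by
    rw [sum_range_succ, cx_gt (k := R + 1) (by omega)]; simp
  simp_rw [mul_add]
  rw [sum_add_distrib, h2, sum_range_succ', sum_range_succ' (fun k => dx (k + 1) * (cx (k + 1) a * cx k a')),
    ← add_assoc, ← sum_add_distrib]
  congr 1
  · refine sum_congr rfl fun k _ => ?_
    rw [cx_succ_succ, dx_succ (k + 1)]
    push_cast
    ring
  · rw [cx_zero_succ, dx_succ]; push_cast; ring

open Finset in
lemma sx_eq (R a a' : ℕ) (h : a + a' ≤ R) :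
    ∑ k ∈ range (R + 1), dx k * cx k a * cx k a' = cx 0 (a + a') := by
  induction a generalizing a' with
  | zero =>
    simp_rw [cx_zero_left_zero]
    simp [dx]
  | succ a ih =>
    have h1 := ih (a' + 1) (by omega)
    rw [show a + 1 + a' = a + (a' + 1) by ring, ← h1, sx_step R a a' (by omega)]
    have : ∀ k ∈ range (R + 1), dx k * cx k a * cx k (a' + 1) = dx k * cx k (a' + 1) * cx k a :=
      fun k _ => by ring
    rw [sum_congr rfl this, sx_step R a' a (by omega)]
    refine sum_congr rfl fun k _ => ?_
    ring

noncomputable def tz (k l b c : ℕ) : ℝ :=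
  if k ≤ b ∧ b + l = c + k then (b.factorial * c.factorial : ℝ) / (b - k).factorial else 0

noncomputable def dz (k l : ℕ) : ℝ := 1 / (k.factorial * l.factorial)

lemma dz_pos (k l : ℕ) : 0 < dz k l := by unfold dz; positivity

open Finset in
lemma sz_eq (R b c b' c' : ℕ) (hb : b ≤ R) (hc : c ≤ R) (hb' : b' ≤ R) (hc' : c' ≤ R) :
    ∑ k ∈ range (R + 1), ∑ l ∈ range (R + 1), dz k l * tz k l b c * tz k l b' c' =
      if b + c' = c + b' then ((b + c').factorial : ℝ) else 0 := by
  split_ifs with h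
  · have hV := Nat.add_choose_eq b c' b'
    rw [Finset.Nat.sum_antidiagonal_eq_sum_range_succ (fun i j => b.choose i * c'.choose j)] at hV
    have hV2 : ((b + c').factorial : ℝ) = c.factorial * b'.factorial *
        ∑ k ∈ range (b' + 1), (b.choose k * c'.choose (b' - k) : ℝ) := by
      have h3 := Nat.choose_mul_factorial_mul_factorial (n := b + c') (k := b') (by omega)
      rw [show b + c' - b' = c by omega, hV] at h3
      rw [← h3]; push_cast; ring
    have hsub : range (b' + 1) ⊆ range (R + 1) := by
      intro x; simp; omega
    rw [hV2, ← sum_subset hsub, mul_sum]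
    · refine sum_congr rfl fun k hk => ?_
      have hk' : k ≤ b' := by simpa [Nat.lt_succ_iff] using hk
      by_cases hl : k ≤ b ∧ b' ≤ c' + k
      · obtain ⟨hkb, hl⟩ := hl
        rw [sum_eq_single (c' + k - b')]
        · unfold tz dz
          rw [if_pos ⟨hkb, by omega⟩, if_pos ⟨hk', by omega⟩,
            Nat.cast_choose ℝ hkb, Nat.cast_choose ℝ (show b' - k ≤ c' by omega),
            show c' - (b' - k) = c' + k - b' by omega]
          field_simp
        · intro l _ hne
          have : tz k l b' c' = 0 := by unfold tz; rw [if_neg]; omega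
          rw [this, mul_zero]
        · intro hn
          exfalso; apply hn; simp; omega
      · rw [sum_eq_zero]
        · rcases not_and_or.mp hl with h1 | h1
          · rw [Nat.choose_eq_zero_of_lt (by omega : b < k)]; simp
          · rw [Nat.choose_eq_zero_of_lt (by omega : c' < b' - k)]; simp
        · intro l _
          by_cases h1 : k ≤ b
          · have : tz k l b' c' = 0 := by unfold tz; rw [if_neg]; omega
            rw [this, mul_zero]
          · have : tz k l b c = 0 := by unfold tz; rw [if_neg]; omega
            rw [this]; simp
    · intro k _ hk
      refine sum_eq_zero fun l _ => ?_
      have : tz k l b' c' = 0 := by unfold tz; rw [if_neg]; simp at hk; omega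
      rw [this, mul_zero]
  · refine sum_eq_zero fun k _ => sum_eq_zero fun l _ => ?_
    by_cases h1 : k ≤ b ∧ b + l = c + k
    · have : tz k l b' c' = 0 := by unfold tz; rw [if_neg]; omega
      rw [this, mul_zero]
    · have : tz k l b c = 0 := by unfold tz; rw [if_neg h1]
      rw [this]; simp

noncomputable def hh (m r : ℕ) (δ : Fin (m + 1) →₀ ℕ) : ℝ :=
  if ∑ i : Fin m, δ i.castSucc + 2 * δ (Fin.last m) = 2 * r then
    r.factorial * (∏ i : Fin m, cx 0 (δ i.castSucc)) * (δ (Fin.last m)).factorial else 0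

def aset (m r : ℕ) : Finset (Fin (m + 1) →₀ ℕ) :=
  (Finset.range (r + 1)).biUnion fun s => Finset.finsuppAntidiag Finset.univ s

lemma mem_aset {m r : ℕ} {α : Fin (m + 1) →₀ ℕ} :
    α ∈ aset m r ↔ ∑ i : Fin m, α i.castSucc + α (Fin.last m) ≤ r := by
  simp [aset, Finset.mem_finsuppAntidiag, Fin.sum_univ_castSucc]

lemma card_aset (m r : ℕ) : (aset m r).card = (m + 1 + r).choose (m + 1) := by
  unfold aset
  rw [Finset.card_biUnion]
  · simp_rw [Finset.card_finsuppAntidiag_nat_eq_choose]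
    have := Nat.sum_range_add_choose r m
    rw [show m + 1 + r = r + m + 1 by ring, ← this]
    refine Finset.sum_congr rfl fun s _ => ?_
    simp only [Finset.card_univ, Fintype.card_fin]
    rw [show m + 1 + s - 1 = s + m by omega]
    exact Nat.choose_symm_add
  · intro s _ t _ hst
    rw [Function.onFun, Finset.disjoint_left]
    intro α h1 h2
    rw [Finset.mem_finsuppAntidiag] at h1 h2
    exact hst (h1.1.symm.trans h2.1)

noncomputable def snocF {m : ℕ} (c : Fin m → ℕ) (k : ℕ) : Fin (m + 1) →₀ ℕ :=
  Finsupp.equivFunOnFinite.symm (Fin.snoc (α := fun _ => ℕ) c k)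

@[simp] lemma snocF_castSucc {m : ℕ} (c : Fin m → ℕ) (k : ℕ) (i : Fin m) :
    snocF c k i.castSucc = c i := by
  simp [snocF]

@[simp] lemma snocF_last {m : ℕ} (c : Fin m → ℕ) (k : ℕ) :
    snocF c k (Fin.last m) = k := by
  simp [snocF]

lemma ext_snoc {m : ℕ} {α β : Fin (m + 1) →₀ ℕ} (h1 : ∀ i : Fin m, α i.castSucc = β i.castSucc)
    (h2 : α (Fin.last m) = β (Fin.last m)) : α = β := by
  ext i
  refine Fin.lastCases h2 h1 i

noncomputable def tt (m r : ℕ) (κ : (Fin m → ℕ) × ℕ × ℕ) (α : Fin (m + 1) →₀ ℕ) : ℝ :=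
  (∏ i : Fin m, cx (κ.1 i) (α i.castSucc)) *
    tz κ.2.1 κ.2.2 (α (Fin.last m)) (r - (∑ i : Fin m, α i.castSucc + α (Fin.last m)))

noncomputable def dd (m r : ℕ) (κ : (Fin m → ℕ) × ℕ × ℕ) : ℝ :=
  r.factorial * (∏ i : Fin m, dx (κ.1 i)) * dz κ.2.1 κ.2.2

def kset (m r : ℕ) : Finset ((Fin m → ℕ) × ℕ × ℕ) :=
  (Fintype.piFinset fun _ => Finset.range (2 * r + 1)) ×ˢ
    (Finset.range (2 * r + 1) ×ˢ Finset.range (2 * r + 1))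

noncomputable def reflF (m r : ℕ) (α : Fin (m + 1) →₀ ℕ) : Fin (m + 1) →₀ ℕ :=
  snocF (fun i => α i.castSucc) (r - (∑ i : Fin m, α i.castSucc + α (Fin.last m)))

lemma reflF_mem {m r : ℕ} {α : Fin (m + 1) →₀ ℕ} (h : α ∈ aset m r) : reflF m r α ∈ aset m r := by
  rw [mem_aset] at *
  simp [reflF]
  omega

lemma kernel_eq {m r : ℕ} {α α' : Fin (m + 1) →₀ ℕ} (h : α ∈ aset m r) (h' : α' ∈ aset m r) :
    hh m r (α + reflF m r α') = ∑ κ ∈ kset m r, dd m r κ * tt m r κ α * tt m r κ α' := by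
  rw [mem_aset] at *
  have hs : ∀ i : Fin m, α i.castSucc ≤ ∑ i : Fin m, α i.castSucc := fun i =>
    Finset.single_le_sum (f := fun i : Fin m => α i.castSucc) (fun _ _ => Nat.zero_le _)
      (Finset.mem_univ i)
  have hs' : ∀ i : Fin m, α' i.castSucc ≤ ∑ i : Fin m, α' i.castSucc := fun i =>
    Finset.single_le_sum (f := fun i : Fin m => α' i.castSucc) (fun _ _ => Nat.zero_le _)
      (Finset.mem_univ i)
  have hx : ∏ i : Fin m, cx 0 (α i.castSucc + α' i.castSucc) =
      ∑ κ ∈ Fintype.piFinset (fun _ : Fin m => Finset.range (2 * r + 1)),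
        ∏ i : Fin m, dx (κ i) * cx (κ i) (α i.castSucc) * cx (κ i) (α' i.castSucc) := by
    rw [← Finset.prod_univ_sum (fun _ : Fin m => Finset.range (2 * r + 1))
      (fun i k => dx k * cx k (α i.castSucc) * cx k (α' i.castSucc))]
    refine Finset.prod_congr rfl fun i _ => ?_
    rw [sx_eq]
    have := hs i
    have := hs' i
    omega
  have hz := sz_eq (2 * r) (α (Fin.last m)) (r - (∑ i : Fin m, α i.castSucc + α (Fin.last m)))
    (α' (Fin.last m)) (r - (∑ i : Fin m, α' i.castSucc + α' (Fin.last m)))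
    (by omega) (by omega) (by omega) (by omega)
  have hlhs : hh m r (α + reflF m r α') = r.factorial *
      ((∏ i : Fin m, cx 0 (α i.castSucc + α' i.castSucc)) *
      (if α (Fin.last m) + (r - (∑ i : Fin m, α' i.castSucc + α' (Fin.last m))) =
        (r - (∑ i : Fin m, α i.castSucc + α (Fin.last m))) + α' (Fin.last m) then
        ((α (Fin.last m) + (r - (∑ i : Fin m, α' i.castSucc + α' (Fin.last m)))).factorial : ℝ)
        else 0)) := by
    unfold hh
    simp only [reflF, Finsupp.add_apply, snocF_castSucc, snocF_last, Finset.sum_add_distrib]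
    split_ifs with h1 h2 h2
    · ring
    · omega
    · omega
    · simp
  rw [hlhs, hx, ← hz, ← Finset.sum_product', Finset.sum_mul_sum, ← Finset.sum_product',
    Finset.mul_sum]
  refine Finset.sum_congr rfl fun κ _ => ?_
  unfold dd tt
  rw [Finset.prod_mul_distrib, Finset.prod_mul_distrib]
  ring

lemma tt_diag {m r : ℕ} (α : Fin (m + 1) →₀ ℕ) (h : α ∈ aset m r) :
    tt m r (fun i => α i.castSucc, α (Fin.last m),
      r - (∑ i : Fin m, α i.castSucc + α (Fin.last m))) α ≠ 0 := by
  unfold tt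
  refine mul_ne_zero (Finset.prod_ne_zero_iff.mpr fun i _ => ?_) ?_
  · have := cx_eq (α i.castSucc) 0
    simp only [mul_zero, add_zero] at this
    rw [this]
    positivity
  · unfold tz
    rw [if_pos ⟨le_refl _, by simp; ring⟩]
    positivity

lemma tt_off {m r : ℕ} {α α' : Fin (m + 1) →₀ ℕ} (h : α ∈ aset m r) (h' : α' ∈ aset m r)
    (hne : tt m r (fun i => α i.castSucc, α (Fin.last m),
      r - (∑ i : Fin m, α i.castSucc + α (Fin.last m))) α' ≠ 0) : α' = α := by
  unfold tt at hne
  rw [mem_aset] at h h'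
  obtain ⟨h1, h2⟩ := mul_ne_zero_iff.mp hne
  rw [Finset.prod_ne_zero_iff] at h1
  have h3 : ∀ i ∈ (Finset.univ : Finset (Fin m)), α i.castSucc ≤ α' i.castSucc := by
    intro i _
    by_contra hc
    exact h1 i (Finset.mem_univ i) (cx_gt (by simpa using hc))
  have h4 : α (Fin.last m) ≤ α' (Fin.last m) ∧ α' (Fin.last m) +
      (r - (∑ i : Fin m, α i.castSucc + α (Fin.last m))) =
      (r - (∑ i : Fin m, α' i.castSucc + α' (Fin.last m))) + α (Fin.last m) := by
    by_contra hc
    apply h2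
    unfold tz
    rw [if_neg hc]
  have h5 := Finset.sum_le_sum h3
  have h6 : ∑ i : Fin m, α i.castSucc = ∑ i : Fin m, α' i.castSucc := by omega
  have h7 := (Finset.sum_eq_sum_iff_of_le h3).mp h6
  exact ext_snoc (fun i => (h7 i (Finset.mem_univ i)).symm) (by omega)

lemma nondeg {m r : ℕ} (p : (Fin (m + 1) →₀ ℕ) → ℂ)
    (h : ∀ β ∈ aset m r, ∑ α ∈ aset m r, p α * (hh m r (α + β) : ℂ) = 0) :
    ∀ α ∈ aset m r, p α = 0 := by
  intro α hα
  have key := psd_zero (aset m r) (kset m r) (dd m r) (tt m r) p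
    (fun κ _ => by
      unfold dd
      have := Finset.prod_pos (s := Finset.univ) (fun i (_ : i ∈ Finset.univ) => dx_pos (κ.1 i))
      have := dz_pos κ.2.1 κ.2.2
      positivity)
    (by
      rw [Finset.sum_comm]
      refine Finset.sum_eq_zero fun α' hα' => ?_
      have := h _ (reflF_mem hα')
      rw [← mul_zero ((starRingEnd ℂ) (p α')), ← this, Finset.mul_sum]
      refine Finset.sum_congr rfl fun α hα => ?_
      rw [kernel_eq hα hα']
      ring)
    (fun i => α i.castSucc, α (Fin.last m), r - (∑ i : Fin m, α i.castSucc + α (Fin.last m)))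
    (by
      have hα2 := mem_aset.mp hα
      simp only [kset, Finset.mem_product, Fintype.mem_piFinset, Finset.mem_range]
      refine ⟨fun i => ?_, by omega, by omega⟩
      have := Finset.single_le_sum (f := fun i : Fin m => α i.castSucc) (fun _ _ => Nat.zero_le _)
        (Finset.mem_univ i)
      omega)
  rw [Finset.sum_eq_single α] at key
  · rcases mul_eq_zero.mp key with h1 | h1
    · exact h1
    · exact absurd (Complex.ofReal_eq_zero.mp h1) (tt_diag α hα)
  · intro α' hα' hne
    have : tt m r (fun i => α i.castSucc, α (Fin.last m),
      r - (∑ i : Fin m, α i.castSucc + α (Fin.last m))) α' = 0 := by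
      by_contra hc
      exact hne (tt_off hα hα' hc)
    rw [this]; simp
  · intro hn; exact absurd hα hn

noncomputable def nu {n : ℕ} (β : Fin n →₀ ℕ) : MvPolynomial (Fin n) ℂ →ₗ[ℂ] ℂ :=
  ((∏ i, (β i).factorial : ℕ) : ℂ) • MvPolynomial.lcoeff ℂ β

lemma nu_apply {n : ℕ} (β : Fin n →₀ ℕ) (f : MvPolynomial (Fin n) ℂ) :
    nu β f = ((∏ i, (β i).factorial : ℕ) : ℂ) * coeff β f := by
  simp [nu]

lemma nu_ext {n : ℕ} {f g : MvPolynomial (Fin n) ℂ} (h : ∀ β, nu β f = nu β g) : f = g := by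
  ext β
  have := h β
  rw [nu_apply, nu_apply] at this
  refine mul_left_cancel₀ ?_ this
  exact_mod_cast (Finset.prod_pos fun i _ => Nat.factorial_pos _).ne'

lemma nu_pderiv {n : ℕ} (β : Fin n →₀ ℕ) (i : Fin n) (f : MvPolynomial (Fin n) ℂ) :
    nu β (pderiv i f) = nu (Finsupp.single i 1 + β) f := by
  rw [nu_apply, nu_apply, coeff_pderiv, add_comm β]
  rw [← Finset.mul_prod_erase _ _ (Finset.mem_univ i),
    ← Finset.mul_prod_erase Finset.univ (fun j => ((Finsupp.single i 1 + β : Fin n →₀ ℕ) j).factorial)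
      (Finset.mem_univ i)]
  have : ∏ x ∈ Finset.univ.erase i, ((Finsupp.single i 1 + β : Fin n →₀ ℕ) x).factorial =
      ∏ x ∈ Finset.univ.erase i, (β x).factorial := by
    refine Finset.prod_congr rfl fun x hx => ?_
    have := Finset.ne_of_mem_erase hx
    simp [Finsupp.single_apply, this.symm]
  rw [this]
  simp only [Finsupp.add_apply, Finsupp.single_eq_same]
  rw [add_comm 1 (β i), Nat.factorial_succ]
  push_cast
  ring

lemma nu_iter {n : ℕ} (i : Fin n) (k : ℕ) (β : Fin n →₀ ℕ) (f : MvPolynomial (Fin n) ℂ) :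
    nu β ((fun h => pderiv i h)^[k] f) = nu (Finsupp.single i k + β) f := by
  induction k generalizing β with
  | zero => simp
  | succ k ih =>
    rw [Function.iterate_succ_apply', nu_pderiv, ih, ← add_assoc, ← Finsupp.single_add]

lemma nu_foldr {n : ℕ} (α : Fin n →₀ ℕ) (l : List (Fin n)) (β : Fin n →₀ ℕ)
    (f : MvPolynomial (Fin n) ℂ) :
    nu β (l.foldr (fun i g => (fun h => pderiv i h)^[α i] g) f) =
      nu ((l.map fun i => Finsupp.single i (α i)).sum + β) f := by
  induction l generalizing β with
  | nil => simp
  | cons i l ih =>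
    rw [List.foldr_cons, nu_iter, ih, List.map_cons, List.sum_cons]
    congr 2
    abel

lemma nu_pdPow {n : ℕ} (α β : Fin n →₀ ℕ) (f : MvPolynomial (Fin n) ℂ) :
    nu β (pdPow α f) = nu (α + β) f := by
  unfold pdPow
  rw [nu_foldr]
  congr 2
  rw [← List.ofFn_eq_map, List.sum_ofFn]
  exact congrArg (· + β) (Finsupp.univ_sum_single α)

lemma q1Form_eq (m : ℕ) : q1Form (m + 1) = ∑ i : Fin m, X i.castSucc ^ 2 := by
  unfold q1Form
  rw [Finset.sum_filter, Fin.sum_univ_castSucc]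
  rw [if_neg (by simp), add_zero]
  refine Finset.sum_congr rfl fun i _ => ?_
  rw [if_pos]
  have := i.2
  simp

lemma monomial_snoc {m : ℕ} (c : Fin m → ℕ) (k : ℕ) (a : ℂ) :
    (monomial (snocF (fun i => 2 * c i) k) a : MvPolynomial (Fin (m + 1)) ℂ) =
      C a * (∏ i : Fin m, (X i.castSucc ^ 2) ^ c i) * X (Fin.last m) ^ k := by
  rw [monomial_eq, Finsupp.prod_fintype _ _ (by simp), Fin.prod_univ_castSucc]
  simp [pow_mul, mul_assoc]

lemma tautF_eq (m r : ℕ) (hn : 1 ≤ m + 1) : tautF (m + 1) r hn =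
    ∑ k ∈ Finset.range (r + 1), ∑ c ∈ Finset.piAntidiag (Finset.univ : Finset (Fin m)) (r - k),
      monomial (snocF (fun i => 2 * c i) k) ((r.factorial : ℂ) / ∏ i, ((c i).factorial : ℂ)) := by
  unfold tautF
  refine Finset.sum_congr rfl fun k _ => ?_
  rw [q1Form_eq, Finset.sum_pow_eq_sum_piAntidiag, Finset.mul_sum, Finset.sum_mul]
  refine Finset.sum_congr rfl fun c hc => ?_
  rw [monomial_snoc]
  have hlast : (⟨m + 1 - 1, by omega⟩ : Fin (m + 1)) = Fin.last m := rfl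
  rw [hlast, ← mul_assoc]
  congr 2
  rw [← map_natCast (C : ℂ →+* MvPolynomial (Fin (m + 1)) ℂ), ← C_mul]
  congr 1
  have hsum : ∑ i, c i = r - k := (Finset.mem_piAntidiag.mp hc).1
  have h1 := Nat.multinomial_spec Finset.univ c
  rw [hsum] at h1
  rw [← h1]
  have h2 : (∏ i, ((c i).factorial : ℂ)) ≠ 0 :=
    Finset.prod_ne_zero_iff.mpr fun i _ => by exact_mod_cast (Nat.factorial_pos _).ne'
  have h3 : ((Nat.multinomial Finset.univ c : ℕ) : ℂ) ≠ 0 := by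
    exact_mod_cast (Nat.multinomial_pos Finset.univ c).ne'
  push_cast
  field_simp

lemma nu_tautF (m r : ℕ) (hn : 1 ≤ m + 1) (δ : Fin (m + 1) →₀ ℕ) :
    nu δ (tautF (m + 1) r hn) = (hh m r δ : ℂ) := by
  rw [nu_apply, tautF_eq]
  simp_rw [coeff_sum, coeff_monomial]
  by_cases hd : (∑ i : Fin m, δ i.castSucc + 2 * δ (Fin.last m) = 2 * r) ∧
      ∀ i : Fin m, Even (δ i.castSucc)
  · obtain ⟨hw, he⟩ := hd
    choose c hc using he
    have hc2 : ∀ i, δ i.castSucc = 2 * c i := fun i => by rw [hc i]; ring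
    have hδ : snocF (fun i => 2 * c i) (δ (Fin.last m)) = δ :=
      ext_snoc (fun i => by simp [hc2]) (by simp)
    have hsum : ∑ i : Fin m, δ i.castSucc = 2 * ∑ i, c i := by
      simp_rw [hc2, Finset.mul_sum]
    rw [Finset.sum_eq_single (δ (Fin.last m)), Finset.sum_eq_single c]
    · rw [if_pos hδ]
      unfold hh
      rw [if_pos hw, Fin.prod_univ_castSucc]
      have h1 : ∀ i : Fin m, cx 0 (δ i.castSucc) =
          ((δ i.castSucc).factorial : ℝ) / (c i).factorial := by
        intro i
        have := cx_eq 0 (c i)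
        rw [zero_add] at this
        rw [hc2, this]; simp
      simp_rw [h1]
      rw [Finset.prod_div_distrib]
      push_cast
      ring
    · intro c' _ hne
      rw [if_neg]
      intro h
      apply hne
      funext i
      have := DFunLike.congr_fun h i.castSucc
      rw [snocF_castSucc, hc2] at this
      omega
    · intro hn
      exfalso; apply hn
      rw [Finset.mem_piAntidiag]
      have h5 : ∑ i, c i = r - δ (Fin.last m) := by omega
      exact ⟨h5, by simp⟩
    · intro k _ hne
      refine Finset.sum_eq_zero fun c' _ => ?_
      rw [if_neg]
      intro h
      apply hne
      have := DFunLike.congr_fun h (Fin.last m)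
      rwa [snocF_last] at this
    · intro hn
      exfalso; apply hn
      rw [Finset.mem_range]; omega
  · have hz : hh m r δ = 0 := by
      unfold hh
      split_ifs with hw
      · have : ∃ i : Fin m, ¬ Even (δ i.castSucc) := by
          by_contra hc
          push Not at hc
          exact hd ⟨hw, hc⟩
        obtain ⟨i, hi⟩ := this
        rw [Finset.prod_eq_zero (Finset.mem_univ i) (cx_odd (by simpa using hi))]
        simp
      · rfl
    rw [hz, Finset.sum_eq_zero]
    · simp
    · intro k hk
      refine Finset.sum_eq_zero fun c hc => ?_
      rw [if_neg]
      rintro rfl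
      apply hd
      have hsum : ∑ i, c i = r - k := (Finset.mem_piAntidiag.mp hc).1
      rw [Finset.mem_range] at hk
      simp only [snocF_castSucc, snocF_last]
      refine ⟨?_, fun i => even_two_mul _⟩
      rw [← Finset.mul_sum]
      omega

theorem statement2 (n r : ℕ) (hn : 1 ≤ n) (hr : 1 ≤ r) :
    Module.finrank ℂ
        (Submodule.span ℂ
          {p : MvPolynomial (Fin n) ℂ | ∃ α : Fin n →₀ ℕ, p = pdPow α (tautF n r hn)})
      = (n + r).choose n := by
  obtain ⟨m, rfl⟩ : ∃ m, n = m + 1 := ⟨n - 1, by omega⟩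
  let v : aset m r → MvPolynomial (Fin (m + 1)) ℂ := fun α => pdPow α.1 (tautF (m + 1) r hn)
  have hv : ∀ (α : aset m r) β, nu β (v α) = (hh m r (α.1 + β) : ℂ) := fun α β => by
    rw [nu_pdPow, nu_tautF]
  have hnd : ∀ p : aset m r → ℂ,
      (∀ β ∈ aset m r, ∑ α : aset m r, p α * (hh m r (α.1 + β) : ℂ) = 0) → p = 0 := by
    intro p hp
    have := nondeg (m := m) (r := r) (fun α => if h : α ∈ aset m r then p ⟨α, h⟩ else 0) (by
      intro β hβ
      rw [← hp β hβ, ← Finset.sum_coe_sort]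
      refine Finset.sum_congr rfl fun α _ => ?_
      simp)
    funext α
    have h2 := this α.1 α.2
    simpa using h2
  have hli : LinearIndependent ℂ v := by
    rw [Fintype.linearIndependent_iff]
    intro g hg i
    have : g = 0 := by
      apply hnd
      intro β _
      have h2 := congrArg (nu β) hg
      rw [map_sum, map_zero] at h2
      rw [← h2]
      refine Finset.sum_congr rfl fun α _ => ?_
      rw [map_smul, hv, smul_eq_mul]
    rw [this]; rfl
  have hspan : Submodule.span ℂ {p : MvPolynomial (Fin (m + 1)) ℂ |
      ∃ α : Fin (m + 1) →₀ ℕ, p = pdPow α (tautF (m + 1) r hn)} =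
      Submodule.span ℂ (Set.range v) := by
    apply le_antisymm
    · rw [Submodule.span_le]
      rintro _ ⟨γ, rfl⟩
      by_cases hγ : γ ∈ aset m r
      · exact Submodule.subset_span ⟨⟨γ, hγ⟩, rfl⟩
      · let M : Matrix (aset m r) (aset m r) ℂ := fun β α => (hh m r (α.1 + β.1) : ℂ)
        have hM : ∀ p β, M.mulVecLin p β = ∑ α : aset m r, p α * (hh m r (α.1 + β.1) : ℂ) := by
          intro p β
          simp only [Matrix.mulVecLin_apply, Matrix.mulVec, dotProduct, M]
          exact Finset.sum_congr rfl fun _ _ => mul_comm _ _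
        have hinj : Function.Injective M.mulVecLin := by
          rw [← LinearMap.ker_eq_bot, LinearMap.ker_eq_bot']
          intro p hp
          apply hnd
          intro β hβ
          rw [← hM p ⟨β, hβ⟩, hp]; rfl
        obtain ⟨p, hp⟩ := LinearMap.injective_iff_surjective.mp hinj
          (fun β => (hh m r (γ + β.1) : ℂ))
        let wt : (Fin (m + 1) →₀ ℕ) → ℕ := fun δ =>
          ∑ i : Fin m, δ i.castSucc + 2 * δ (Fin.last m)
        have wt_add : ∀ a b, wt (a + b) = wt a + wt b := by
          intro a b
          simp only [wt, Finsupp.add_apply, Finset.sum_add_distrib]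
          ring
        have hh0 : ∀ δ, wt δ ≠ 2 * r → hh m r δ = 0 := fun δ h => if_neg h
        have : pdPow γ (tautF (m + 1) r hn) =
            ∑ α : aset m r, (if wt α.1 = wt γ then p α else 0) • v α := by
          apply nu_ext
          intro β
          rw [nu_pdPow, nu_tautF, map_sum]
          simp_rw [map_smul, hv, smul_eq_mul]
          by_cases hw : wt γ + wt β = 2 * r
          · have hβ : β ∈ aset m r := by
              rw [mem_aset] at *
              simp only [wt] at hw
              omega
            have h1 := congrFun hp ⟨β, hβ⟩
            rw [hM] at h1
            simp only at h1
            rw [← h1]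
            refine Finset.sum_congr rfl fun α _ => ?_
            split_ifs with h2
            · rfl
            · rw [hh0 (α.1 + β) (by rw [wt_add]; omega)]; simp
          · rw [hh0 (γ + β) (by rw [wt_add]; exact hw), Finset.sum_eq_zero]
            · simp
            · intro α _
              split_ifs with h2
              · rw [hh0 (α.1 + β) (by rw [wt_add]; omega)]; simp
              · simp
        rw [this]
        exact Submodule.sum_mem _ fun α _ =>
          Submodule.smul_mem _ _ (Submodule.subset_span ⟨α, rfl⟩)
    · apply Submodule.span_mono
      rintro _ ⟨α, rfl⟩
      exact ⟨α.1, rfl⟩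
  rw [hspan, finrank_span_eq_card hli, Fintype.card_coe, card_aset]
end

section
/- The Waring rank of the quartic (x_0x_1 + x_2x_3)^2 ∈ ℂ[x_0,x_1,x_2,x_3] is exactly 11: there exist 11 homogeneous linear forms l_1,…,l_11 ∈ ℂ[x_0,x_1,x_2,x_3] and scalars c_1,…,c_11 ∈ ℂ with (x_0x_1+x_2x_3)^2 = Σ_{i=1}^{11} c_i·l_i^4, but there do not exist 10 homogeneous linear forms l_1,…,l_10 and scalars c_1,…,c_10 ∈ ℂ with (x_0x_1+x_2x_3)^2 = Σ_{i=1}^{10} c_i·l_i^4. -/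
open MvPolynomial

namespace WaringAux

/-- A homogeneous form of degree one is a linear combination of the variables. -/
lemma linear_form {l : MvPolynomial (Fin 4) ℂ} (h : l.IsHomogeneous 1) :
    ∃ a : Fin 4 → ℂ, ∀ x : Fin 4 → ℂ, eval x l = ∑ k, a k * x k := by
  have h1 : l ∈ homogeneousSubmodule (Fin 4) ℂ 1 := h
  rw [homogeneousSubmodule_one_eq_span_X, Submodule.mem_span_range_iff_exists_fun] at h1
  obtain ⟨a, ha⟩ := h1
  refine ⟨a, fun x => ?_⟩
  rw [← ha]
  simp [smul_eval]

/-- The linear form with given coefficients. -/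
noncomputable def lin (a : Fin 4 → ℂ) : MvPolynomial (Fin 4) ℂ := ∑ k, C (a k) * X k

lemma lin_hom (a : Fin 4 → ℂ) : (lin a).IsHomogeneous 1 := by
  refine IsHomogeneous.sum _ _ _ fun k _ => ?_
  simpa using (isHomogeneous_C (Fin 4) (a k)).mul (isHomogeneous_X ℂ k)

lemma eval_lin (a x : Fin 4 → ℂ) : eval x (lin a) = ∑ k, a k * x k := by
  simp [lin]

/-- A nonsingular 6 by 6 matrix: `w` on the diagonal, signs elsewhere, `w ^ 2 = 6`. -/
lemma det_ne_zero (w : ℂ) (hw : w * w = 6) (M : Matrix (Fin 6) (Fin 6) ℂ)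
    (hd : ∀ i, M i i = w) (ho : ∀ i j, i ≠ j → M i j = 1 ∨ M i j = -1) : M.det ≠ 0 := by
  classical
  let φ : ℤ√6 →+* ℂ := Zsqrtd.lift ⟨w, by rw [hw]; norm_num⟩
  have hφ : Function.Injective φ := by
    apply Zsqrtd.lift_injective
    intro n hn
    have h1 : n < 3 := by nlinarith
    have h2 : -3 < n := by nlinarith
    interval_cases n <;> omega
  let ψ : ℤ√6 →+* ZMod 2 := Zsqrtd.lift ⟨0, by decide⟩
  let N : Matrix (Fin 6) (Fin 6) (ℤ√6) :=
    fun i j => if i = j then Zsqrtd.sqrtd else if M i j = 1 then 1 else -1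
  have hN : φ.mapMatrix N = M := by
    ext i j
    change φ (N i j) = M i j
    by_cases hij : i = j
    · subst hij
      simp [N, φ, hd]
    · rcases ho i j hij with h | h
      · simp [N, hij, h]
      · have : (-1 : ℂ) ≠ 1 := by norm_num
        simp [N, hij, h, this]
  let J : Matrix (Fin 6) (Fin 6) (ZMod 2) := fun i j => if i = j then 0 else 1
  have hJ : ψ.mapMatrix N = J := by
    ext i j
    change ψ (N i j) = J i j
    by_cases hij : i = j
    · subst hij
      simp [N, ψ, J]
    · have h2 : (-1 : ZMod 2) = 1 := by decide
      by_cases h : M i j = 1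
      · simp [N, hij, h, J]
      · simp [N, hij, h, J, h2]
  have hJ2 : J * J = 1 := by decide
  intro h0
  rw [← hN, ← RingHom.map_det] at h0
  have h1 : N.det = 0 := hφ (by rw [h0, map_zero])
  have h3 : J.det = 0 := by rw [← hJ, ← RingHom.map_det, h1, map_zero]
  have h4 := congrArg Matrix.det hJ2
  rw [Matrix.det_mul, h3] at h4
  simp at h4

/-- The dual bilinear form. -/
def bil (a b : Fin 4 → ℂ) : ℂ := a 0 * b 1 + a 1 * b 0 + a 2 * b 3 + a 3 * b 2

/-- No six equiangular vectors with squared cosine `1/6` in four-dimensional space. -/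
lemma no_six (a : Fin 6 → Fin 4 → ℂ) (hn : ∀ i, bil (a i) (a i) ≠ 0)
    (ho : ∀ i j, i ≠ j → 6 * bil (a i) (a j) ^ 2 = bil (a i) (a i) * bil (a j) (a j)) :
    False := by
  obtain ⟨w, hw⟩ := IsAlgClosed.exists_pow_nat_eq (6 : ℂ) (n := 2) (by norm_num)
  choose s hs using fun i =>
    IsAlgClosed.exists_pow_nat_eq (bil (a i) (a i)) (n := 2) (by norm_num)
  have hs0 : ∀ i, s i ≠ 0 := by
    intro i h
    apply hn i
    rw [← hs i, h]
    norm_num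
  let P : Matrix (Fin 6) (Fin 4) ℂ := fun i k => w * a i k / s i
  let R : Matrix (Fin 4) (Fin 6) ℂ :=
    fun k j => (![a j 1, a j 0, a j 3, a j 2] : Fin 4 → ℂ) k / s j
  have hPR : ∀ i j, (P * R) i j = w * bil (a i) (a j) / (s i * s j) := by
    intro i j
    have h1 := hs0 i
    have h2 := hs0 j
    rw [Matrix.mul_apply]
    simp only [Fin.sum_univ_four, P, R, bil]
    simp
    field_simp
  refine det_ne_zero w (by rw [← hw]; ring) (P * R) ?_ ?_ ?_
  · intro i
    have h1 := hs0 i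
    rw [hPR, ← hs i]
    field_simp
  · intro i j hij
    have h1 := hs0 i
    have h2 := hs0 j
    rw [← sq_eq_one_iff, hPR, div_pow, mul_pow, mul_pow, hs, hs, hw,
      ho i j hij]
    exact div_self (mul_ne_zero (hn i) (hn j))
  · by_contra h
    have h1 : (P * R).rank = 6 := by
      simpa using Matrix.rank_of_isUnit (P * R)
        ((Matrix.isUnit_iff_isUnit_det _).2 (isUnit_iff_ne_zero.2 h))
    have h2 := Matrix.rank_mul_le_left P R
    have h3 := Matrix.rank_le_card_width P
    simp at h3
    omega

lemma polar (a : Fin 10 → Fin 4 → ℂ) (c : Fin 10 → ℂ)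
    (h : ∀ x : Fin 4 → ℂ, (x 0 * x 1 + x 2 * x 3) ^ 2 = ∑ i, c i * (∑ k, a i k * x k) ^ 4)
    (u v w z : Fin 4 → ℂ) :
    12 * ∑ i, c i * ((∑ k, a i k * u k) * (∑ k, a i k * v k) * (∑ k, a i k * w k)
      * (∑ k, a i k * z k)) =
    bil u v * bil w z + bil u w * bil v z + bil u z * bil v w := by
  have key : 192 * ∑ i, c i * ((∑ k, a i k * u k) * (∑ k, a i k * v k) * (∑ k, a i k * w k)
      * (∑ k, a i k * z k)) =
      ∑ i, c i * (∑ k, a i k * (u + v + w + z) k) ^ 4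
      - ∑ i, c i * (∑ k, a i k * (u + v + w - z) k) ^ 4
      - ∑ i, c i * (∑ k, a i k * (u + v - w + z) k) ^ 4
      - ∑ i, c i * (∑ k, a i k * (u - v + w + z) k) ^ 4
      + ∑ i, c i * (∑ k, a i k * (u + v - w - z) k) ^ 4
      + ∑ i, c i * (∑ k, a i k * (u - v + w - z) k) ^ 4
      + ∑ i, c i * (∑ k, a i k * (u - v - w + z) k) ^ 4
      - ∑ i, c i * (∑ k, a i k * (u - v - w - z) k) ^ 4 := by
    simp only [← Finset.sum_add_distrib, ← Finset.sum_sub_distrib, Finset.mul_sum (a := (192 : ℂ))]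
    refine Finset.sum_congr rfl fun i _ => ?_
    simp only [Pi.add_apply, Pi.sub_apply, mul_add, mul_sub, Finset.sum_add_distrib,
      Finset.sum_sub_distrib]
    ring
  simp only [← h] at key
  simp only [Pi.add_apply, Pi.sub_apply] at key
  simp only [bil]
  linear_combination key / 16

/-- The bilinear form on basis vectors. -/
def B (k l : Fin 4) : ℂ := if l = (![1, 0, 3, 2] : Fin 4 → Fin 4) k then 1 else 0

lemma moments (a : Fin 10 → Fin 4 → ℂ) (c : Fin 10 → ℂ)
    (h : ∀ x : Fin 4 → ℂ, (x 0 * x 1 + x 2 * x 3) ^ 2 = ∑ i, c i * (∑ k, a i k * x k) ^ 4)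
    (k l m n : Fin 4) :
    ∑ i, c i * (a i k * a i l * a i m * a i n) =
    (B k l * B m n + B k m * B l n + B k n * B l m) / 12 := by
  have hB : ∀ k l, bil (Pi.single k 1) (Pi.single l 1) = B k l := by
    intro k l
    fin_cases k <;> fin_cases l <;> simp [bil, B, Pi.single_apply]
  have := polar a c h (Pi.single k 1) (Pi.single l 1) (Pi.single m 1) (Pi.single n 1)
  simp only [hB] at this
  rw [← this]
  simp [Pi.single_apply]

/-- First index of the `α`-th quadratic monomial. -/
def fi : Fin 10 → Fin 4 := ![0, 1, 2, 3, 0, 0, 0, 1, 1, 2]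
/-- Second index of the `α`-th quadratic monomial. -/
def se : Fin 10 → Fin 4 := ![0, 1, 2, 3, 1, 2, 3, 2, 3, 3]
/-- Multiplicity. -/
def mu : Fin 10 → ℂ := ![1, 1, 1, 1, 2, 2, 2, 2, 2, 2]
/-- The involution on indices. -/
def inv : Fin 4 → Fin 4 := ![1, 0, 3, 2]

lemma no_ten (a : Fin 10 → Fin 4 → ℂ) (c : Fin 10 → ℂ)
    (h : ∀ x : Fin 4 → ℂ, (x 0 * x 1 + x 2 * x 3) ^ 2 = ∑ i, c i * (∑ k, a i k * x k) ^ 4) :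
    False := by
  have hM := moments a c h
  let V : Matrix (Fin 10) (Fin 10) ℂ := fun α i => a i (fi α) * a i (se α)
  let W : Matrix (Fin 10) (Fin 10) ℂ := fun i β =>
    mu β * c i * (6 * (a i (inv (fi β)) * a i (inv (se β)))
      - B (fi β) (se β) * (2 * (a i 0 * a i 1 + a i 2 * a i 3)))
  have hVW : V * W = 1 := by
    ext α β
    have h1 : (V * W) α β = mu β * (6 * ∑ i, c i * (a i (fi α) * a i (se α) *
        a i (inv (fi β)) * a i (inv (se β))) - 2 * B (fi β) (se β) *
        (∑ i, c i * (a i (fi α) * a i (se α) * a i 0 * a i 1)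
          + ∑ i, c i * (a i (fi α) * a i (se α) * a i 2 * a i 3))) := by
      rw [Matrix.mul_apply]
      simp only [Finset.mul_sum, V, W, ← Finset.sum_add_distrib,
        ← Finset.sum_sub_distrib]
      refine Finset.sum_congr rfl fun i _ => ?_
      ring
    rw [h1]
    simp only [hM]
    fin_cases α <;> fin_cases β <;> simp [fi, se, inv, mu, B, Matrix.one_apply] <;> norm_num
  have hWV := mul_eq_one_comm.1 hVW
  have hE : ∀ i j, (W * V) i j =
      c i * (6 * bil (a i) (a j) ^ 2 - bil (a i) (a i) * bil (a j) (a j)) := by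
    intro i j
    rw [Matrix.mul_apply]
    simp only [V, W, bil, Fin.sum_univ_succ]
    simp [fi, se, inv, mu, B]
    ring
  have hdiag : ∀ i, c i * (6 * bil (a i) (a i) ^ 2 - bil (a i) (a i) * bil (a i) (a i)) = 1 := by
    intro i
    rw [← hE, hWV, Matrix.one_apply_eq]
  have hc : ∀ i, c i ≠ 0 := by
    intro i hi
    have := hdiag i
    simp [hi] at this
  have hn : ∀ i, bil (a i) (a i) ≠ 0 := by
    intro i hi
    have := hdiag i
    simp [hi] at this
  have ho : ∀ i j, i ≠ j → 6 * bil (a i) (a j) ^ 2 = bil (a i) (a i) * bil (a j) (a j) := by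
    intro i j hij
    have h1 := hE i j
    rw [hWV, Matrix.one_apply_ne hij] at h1
    exact sub_eq_zero.1 ((mul_eq_zero.1 h1.symm).resolve_left (hc i))
  refine no_six (fun i => a (Fin.castLE (by norm_num) i)) (fun i => hn _) fun i j hij => ho _ _ ?_
  intro h
  exact hij (Fin.castLE_injective _ h)

/-- Coordinates in which the quadric becomes `2 y₀² + y₁² + y₂² + y₃²`; the linear form
`∑ b k * y k`. -/
noncomputable def lf (r : ℂ) (b : Fin 4 → ℂ) : Fin 4 → ℂ :=
  ![(b 2 - b 3 * Complex.I) / 2, (b 2 + b 3 * Complex.I) / 2,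
    (b 0 * r / 2 - b 1 * Complex.I) / 2, (b 0 * r / 2 + b 1 * Complex.I) / 2]

/-- The eleven forms in the coordinates `y`. -/
noncomputable def pts : Fin 11 → Fin 4 → ℂ :=
  ![![2, 0, 0, 0],
    ![0, 1/2, 1/2, 1/2], ![0, 1/2, -1/2, -1/2], ![0, -1/2, 1/2, -1/2], ![0, -1/2, -1/2, 1/2],
    ![1, 1, 0, 0], ![1, -1, 0, 0], ![1, 0, 1, 0], ![1, 0, -1, 0], ![1, 0, 0, 1], ![1, 0, 0, -1]]

/-- The eleven weights. -/
noncomputable def wts : Fin 11 → ℂ :=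
  ![1/8, 4/3, 4/3, 4/3, 4/3, 1/3, 1/3, 1/3, 1/3, 1/3, 1/3]

lemma eleven (r : ℂ) (hr : r ^ 2 = 2) (x : Fin 4 → ℂ) :
    (x 0 * x 1 + x 2 * x 3) ^ 2 = ∑ i, wts i * (∑ k, lf r (pts i) k * x k) ^ 4 := by
  obtain ⟨y, hy⟩ : ∃ y : Fin 4 → ℂ, y = ![r * (x 2 + x 3) / 4, -Complex.I * (x 2 - x 3) / 2,
    (x 0 + x 1) / 2, -Complex.I * (x 0 - x 1) / 2] := ⟨_, rfl⟩
  have hI : Complex.I ^ 2 = -1 := Complex.I_sq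
  have hq : x 0 * x 1 + x 2 * x 3 = 2 * y 0 ^ 2 + y 1 ^ 2 + y 2 ^ 2 + y 3 ^ 2 := by
    simp [hy]
    linear_combination (-(x 2 + x 3) ^ 2 / 8) * hr
      - ((x 2 - x 3) ^ 2 / 4 + (x 0 - x 1) ^ 2 / 4) * hI
  have hl : ∀ b : Fin 4 → ℂ, ∑ k, lf r b k * x k = ∑ k, b k * y k := by
    intro b
    simp [hy, Fin.sum_univ_four, lf]
    ring
  rw [hq]
  simp only [hl]
  simp only [Fin.sum_univ_succ, wts, pts]
  simp
  ring

end WaringAux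

open WaringAux in
/-- The Waring rank of `(x_0x_1 + x_2x_3)^2` is exactly 11: it is a linear combination
of 11 fourth powers of homogeneous linear forms, but not of 10. -/
theorem statement6 :
    (∃ (l : Fin 11 → MvPolynomial (Fin 4) ℂ) (c : Fin 11 → ℂ),
        (∀ i, (l i).IsHomogeneous 1) ∧
        (X 0 * X 1 + X 2 * X 3 : MvPolynomial (Fin 4) ℂ) ^ 2
          = ∑ i, C (c i) * l i ^ 4) ∧
    ¬ (∃ (l : Fin 10 → MvPolynomial (Fin 4) ℂ) (c : Fin 10 → ℂ),
        (∀ i, (l i).IsHomogeneous 1) ∧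
        (X 0 * X 1 + X 2 * X 3 : MvPolynomial (Fin 4) ℂ) ^ 2
          = ∑ i, C (c i) * l i ^ 4) := by
  constructor
  · obtain ⟨r, hr⟩ := IsAlgClosed.exists_pow_nat_eq (2 : ℂ) (n := 2) (by norm_num)
    refine ⟨fun i => lin (lf r (pts i)), wts, fun i => lin_hom _, ?_⟩
    apply MvPolynomial.funext
    intro x
    have := eleven r hr x
    simpa only [map_pow, map_add, map_mul, eval_X, map_sum, eval_C, eval_lin] using this
  · rintro ⟨l, c, hl, h⟩
    choose a ha using fun i => linear_form (hl i)
    refine no_ten a c fun x => ?_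
    have := congrArg (eval x) h
    simpa only [map_pow, map_add, map_mul, eval_X, map_sum, eval_C, ha] using this
end

section
/- The Waring rank of the sextic (x_0^2 + x_1x_2)^3 ∈ ℂ[x_0,x_1,x_2] is exactly 11: there exist 11 homogeneous linear forms l_1,…,l_11 ∈ ℂ[x_0,x_1,x_2] and scalars c_1,…,c_11 ∈ ℂ with (x_0^2+x_1x_2)^3 = Σ_{i=1}^{11} c_i·l_i^6, but there do not exist 10 homogeneous linear forms l_1,…,l_10 and scalars c_1,…,c_10 ∈ ℂ with (x_0^2+x_1x_2)^3 = Σ_{i=1}^{10} c_i·l_i^6. -/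
open MvPolynomial

lemma aux_seven (e0 e1 e2 e3 e4 e5 e6 : ℂ)
    (h : ∀ t : ℂ, e0 + e1*t + e2*t^2 + e3*t^3 + e4*t^4 + e5*t^5 + e6*t^6 = 0) :
    e0 = 0 ∧ e1 = 0 ∧ e2 = 0 ∧ e3 = 0 ∧ e4 = 0 ∧ e5 = 0 ∧ e6 = 0 := by
  have h0 := h 0
  have h1 := h 1
  have h2 := h 2
  have h3 := h 3
  have h4 := h (-1)
  have h5 := h (-2)
  have h6 := h (-3)
  norm_num at h0 h1 h2 h3 h4 h5 h6
  subst h0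
  refine ⟨rfl, ?_, ?_, ?_, ?_, ?_, ?_⟩ <;> grind

/-- Fifth roots of unity orbit sum. -/
lemma orbit_sum (z a x y w : ℂ) (hz : 1 + z + z^2 + z^3 + z^4 = 0) :
    (a*x + y + w)^6 + (a*x + z*y + z^4*w)^6 + (a*x + z^2*y + z^3*w)^6
      + (a*x + z^3*y + z^2*w)^6 + (a*x + z^4*y + z*w)^6
    = 5*(a^6*x^6 + 30*a^4*x^4*(y*w) + 90*a^2*x^2*(y*w)^2 + 20*(y*w)^3
        + 6*a*x*(y^5+w^5)) := by
  have h5 : z^5 = 1 := by linear_combination (z-1)*hz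
  have h4 : z^4 = -1 - z - z^2 - z^3 := by linear_combination hz
  have key : ∀ u v : ℂ, u * v = 1 → ∀ b : ℂ, (b + u*y + v*w)^6 =
      b^6 + 30*b^4*(y*w) + 90*b^2*(y*w)^2 + 20*(y*w)^3
      + u*(6*b^5*y + 60*b^3*y^2*w+60*b*y^3*w^2) + v*(6*b^5*w+60*b^3*y*w^2+60*b*y^2*w^3)
      + u^2*(15*b^4*y^2+60*b^2*y^3*w+15*y^4*w^2) + v^2*(15*b^4*w^2+60*b^2*y*w^3+15*y^2*w^4)
      + u^3*(20*b^3*y^3+30*b*y^4*w) + v^3*(20*b^3*w^3+30*b*y*w^4)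
      + u^4*(15*b^2*y^4+6*y^5*w) + v^4*(15*b^2*w^4+6*y*w^5)
      + u^5*(6*b*y^5) + v^5*(6*b*w^5) + u^6*y^6+v^6*w^6 := by
    intro u v huv b
    grind
  have s2 : 1 + z^2 + (z^2)^2 + (z^3)^2 + (z^4)^2 = 0 := by
    linear_combination hz + (z+z^3)*h5
  have s3 : 1 + z^3 + (z^2)^3 + (z^3)^3 + (z^4)^3 = 0 := by
    linear_combination hz + (z+z^4+z^2*(z^5+1))*h5
  have s4 : 1 + z^4 + (z^2)^4 + (z^3)^4 + (z^4)^4 = 0 := by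
    linear_combination hz + (z^3+z^2*(z^5+1)+z*(z^10+z^5+1))*h5
  have e2 : (z^2)^5 = 1 := by rw [← pow_mul, mul_comm, pow_mul, h5, one_pow]
  have e3 : (z^3)^5 = 1 := by rw [← pow_mul, mul_comm, pow_mul, h5, one_pow]
  have e4 : (z^4)^5 = 1 := by rw [← pow_mul, mul_comm, pow_mul, h5, one_pow]
  have k0 := key 1 1 (by ring) (a*x)
  have k1 := key z (z^4) (by linear_combination h5) (a*x)
  have k2 := key (z^2) (z^3) (by linear_combination h5) (a*x)
  have k3 := key (z^3) (z^2) (by linear_combination h5) (a*x)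
  have k4 := key (z^4) z (by linear_combination h5) (a*x)
  rw [one_mul, one_mul] at k0
  rw [k0, k1, k2, k3, k4]
  simp only [pow_succ _ 5, e2, e3, e4, h5]
  clear key k0 k1 k2 k3 k4
  linear_combination (6*(a*x)^5*y + 60*(a*x)^3*y^2*w+60*(a*x)*y^3*w^2 + y^6 + 6*(a*x)^5*w+60*(a*x)^3*y*w^2+60*(a*x)*y^2*w^3+w^6) * hz
    + (15*(a*x)^4*y^2+60*(a*x)^2*y^3*w+15*y^4*w^2 + 15*(a*x)^4*w^2+60*(a*x)^2*y*w^3+15*y^2*w^4) * s2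
    + (20*(a*x)^3*y^3+30*(a*x)*y^4*w + 20*(a*x)^3*w^3+30*(a*x)*y*w^4) * s3
    + (15*(a*x)^2*y^4+6*y^5*w + 15*(a*x)^2*w^4+6*y*w^5) * s4

lemma int_contra (S : Matrix (Fin 10) (Fin 10) ℤ) (s : ℂ) (hs : s^2 = 3/7) (w : Fin 10 → ℂ) (hw : w ≠ 0)
    (h : ∀ i, w i + s * ∑ j, (S i j : ℂ) * w j = 0) : False := by
  have hs0 : s ≠ 0 := by rintro rfl; norm_num at hs
  set μ : ℂ := - s⁻¹ with hμ
  have hdet : (Matrix.scalar (Fin 10) μ - S.map (Int.castRingHom ℂ)).det = 0 := by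
    rw [← Matrix.exists_mulVec_eq_zero_iff]
    refine ⟨w, hw, ?_⟩
    rw [Matrix.sub_mulVec]
    ext i
    have := h i
    simp [Matrix.mulVec, dotProduct]
    have h2 : ∑ j, (S i j : ℂ) * w j = - s⁻¹ * w i := by
      field_simp
      linear_combination this
    rw [h2]; ring
  have hint : IsIntegral ℤ μ := by
    refine ⟨S.charpoly, Matrix.charpoly_monic S, ?_⟩
    rw [← Matrix.eval_charpoly, Matrix.charpoly_map, Polynomial.eval_map] at hdet
    exact hdet
  have h2 : IsIntegral ℤ ((7/3 : ℚ) : ℂ) := by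
    have := hint.pow 2
    have e : μ^2 = ((7/3 : ℚ) : ℂ) := by
      rw [hμ, neg_sq, inv_pow, hs]; norm_num
    rwa [e] at this
  have h3 : IsIntegral ℤ (7/3 : ℚ) := by
    have := (isIntegral_algebraMap_iff (R := ℤ) (A := ℚ) (B := ℂ) (algebraMap ℚ ℂ).injective (x := 7/3)).1 (by simpa using h2)
    exact this
  obtain ⟨n, hn⟩ := IsIntegrallyClosed.isIntegral_iff.1 h3
  simp at hn
  have : (3 * n : ℚ) = 7 := by rw [hn]; norm_num
  have : 3 * n = 7 := by exact_mod_cast this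
  omega

lemma upper_bound : ∃ (l : Fin 11 → MvPolynomial (Fin 3) ℂ) (c : Fin 11 → ℂ),
        (∀ i, (l i).IsHomogeneous 1) ∧
        (X 0 ^ 2 + X 1 * X 2 : MvPolynomial (Fin 3) ℂ) ^ 3
          = ∑ i, C (c i) * l i ^ 6 := by
  obtain ⟨p, hp⟩ : ∃ p : ℂ, p^2 = 7/3 := IsAlgClosed.exists_pow_nat_eq _ (by norm_num)
  obtain ⟨r, hr⟩ : ∃ r : ℂ, r^2 = 5 := IsAlgClosed.exists_pow_nat_eq _ (by norm_num)
  obtain ⟨z, hz⟩ : ∃ z : ℂ, 1 + z + z^2 + z^3 + z^4 = 0 := by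
    have hprim := Complex.isPrimitiveRoot_exp 5 (by norm_num)
    have hsum := hprim.geom_sum_eq_zero (by norm_num)
    simp only [Finset.sum_range_succ, Finset.sum_range_zero, pow_zero, pow_one, zero_add] at hsum
    exact ⟨_, hsum⟩
  let L : ℂ → ℂ → ℂ → MvPolynomial (Fin 3) ℂ := fun a b d => C a * X 0 + C b * X 1 + C d * X 2
  have hL : ∀ a b d, (L a b d).IsHomogeneous 1 := fun a b d =>
    ((isHomogeneous_C_mul_X _ _).add (isHomogeneous_C_mul_X _ _)).add (isHomogeneous_C_mul_X _ _)
  obtain ⟨a, ha⟩ : ∃ a, a = (p+r)/2 := ⟨_, rfl⟩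
  obtain ⟨a', ha'⟩ : ∃ a', a' = (p-r)/2 := ⟨_, rfl⟩
  obtain ⟨c, hc⟩ : ∃ c, c = -(p-r)*r/1000 := ⟨_, rfl⟩
  obtain ⟨c', hc'⟩ : ∃ c', c' = (p+r)*r/1000 := ⟨_, rfl⟩
  have m0 : c + c' = 1/100 := by subst hc hc'; linear_combination hr/500
  have m1 : c*a + c'*a' = 0 := by subst ha ha' hc hc'; ring
  have m2 : c*a^2 + c'*a'^2 = 1/150 := by subst ha ha' hc hc'; grind
  have m4 : c*a^4 + c'*a'^4 = 1/50 := by subst ha ha' hc hc'; grind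
  refine ⟨![L 1 0 0, L a 1 1, L a z (z^4), L a (z^2) (z^3), L a (z^3) (z^2), L a (z^4) z,
     L a' 1 1, L a' z (z^4), L a' (z^2) (z^3), L a' (z^3) (z^2), L a' (z^4) z],
     ![1 - 5*(c*a^6+c'*a'^6), c, c, c, c, c, c', c', c', c', c'], ?_, ?_⟩
  · intro i; fin_cases i <;> exact hL _ _ _
  · apply MvPolynomial.funext
    intro x
    have o1 := orbit_sum z a (x 0) (x 1) (x 2) hz
    have o2 := orbit_sum z a' (x 0) (x 1) (x 2) hz
    simp [Fin.sum_univ_succ, L]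
    generalize x 0 = u at *
    generalize x 1 = v at *
    generalize x 2 = w at *
    linear_combination (-c)*o1 + (-c')*o2 - 100*(v*w)^3*m0 - 30*u*(v^5+w^5)*m1 - 450*u^2*(v*w)^2*m2 - 150*u^4*v*w*m4

lemma linear_form (l : MvPolynomial (Fin 3) ℂ) (h : l.IsHomogeneous 1) :
    ∃ a b d : ℂ, l = C a * X 0 + C b * X 1 + C d * X 2 := by
  have h1 : l ∈ homogeneousSubmodule (Fin 3) ℂ 1 := h
  rw [homogeneousSubmodule_one_eq_span_X, Submodule.mem_span_range_iff_exists_fun] at h1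
  obtain ⟨c, hc⟩ := h1
  refine ⟨c 0, c 1, c 2, ?_⟩
  rw [← hc]
  simp [Fin.sum_univ_succ, MvPolynomial.smul_eq_C_mul, add_assoc]

noncomputable def Hm : Matrix (Fin 10) (Fin 10) ℂ :=
 !![1,1/10,0,0,0,0,0,0,0,0;
    1/10,1/30,0,0,0,0,0,0,0,0;
    0,0,0,0,1/10,1/30,0,0,0,0;
    0,0,0,0,1/30,1/20,0,0,0,0;
    0,0,1/10,1/30,0,0,0,0,0,0;
    0,0,1/30,1/20,0,0,0,0,0,0;
    0,0,0,0,0,0,0,1/30,0,0;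
    0,0,0,0,0,0,1/30,0,0,0;
    0,0,0,0,0,0,0,0,0,1/20;
    0,0,0,0,0,0,0,0,1/20,0]

noncomputable def Hi : Matrix (Fin 10) (Fin 10) ℂ :=
 !![10/7,-30/7,0,0,0,0,0,0,0,0;
    -30/7,300/7,0,0,0,0,0,0,0,0;
    0,0,0,0,90/7,-60/7,0,0,0,0;
    0,0,0,0,-60/7,180/7,0,0,0,0;
    0,0,90/7,-60/7,0,0,0,0,0,0;
    0,0,-60/7,180/7,0,0,0,0,0,0;
    0,0,0,0,0,0,0,30,0,0;
    0,0,0,0,0,0,30,0,0,0;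
    0,0,0,0,0,0,0,0,0,20;
    0,0,0,0,0,0,0,0,20,0]

lemma Hm_mul_Hi : Hm * Hi = 1 := by
  ext i j
  fin_cases i <;> fin_cases j <;> simp [Hm, Hi, Matrix.mul_apply, Fin.sum_univ_succ] <;> norm_num

lemma moments (a b d c : Fin 10 → ℂ)
    (h : ∀ y z : ℂ, (1 + y*z)^3 = ∑ i, c i * (a i + b i * y + d i * z)^6) (M : ℕ → ℕ → ℕ → ℂ)
    (hM : ∀ i j k, M i j k = ∑ n, c n * (a n ^ i * b n ^ j * d n ^ k)) :
    (M 6 0 0 = 1 ∧ M 5 0 1 = 0 ∧ M 4 0 2 = 0 ∧ M 3 0 3 = 0 ∧ M 2 0 4 = 0 ∧ M 1 0 5 = 0 ∧ M 0 0 6 = 0) ∧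
    (M 5 1 0 = 0 ∧ M 4 1 1 = 1/10 ∧ M 3 1 2 = 0 ∧ M 2 1 3 = 0 ∧ M 1 1 4 = 0 ∧ M 0 1 5 = 0) ∧
    (M 4 2 0 = 0 ∧ M 3 2 1 = 0 ∧ M 2 2 2 = 1/30 ∧ M 1 2 3 = 0 ∧ M 0 2 4 = 0) ∧
    (M 3 3 0 = 0 ∧ M 2 3 1 = 0 ∧ M 1 3 2 = 0 ∧ M 0 3 3 = 1/20) ∧
    (M 2 4 0 = 0 ∧ M 1 4 1 = 0 ∧ M 0 4 2 = 0) ∧ (M 1 5 0 = 0 ∧ M 0 5 1 = 0) ∧ M 0 6 0 = 0 := by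
  have key : ∀ z y : ℂ,
      ((M 6 0 0 - 1) + 6*M 5 0 1*z + 15*M 4 0 2*z^2 + 20*M 3 0 3*z^3 + 15*M 2 0 4*z^4 + 6*M 1 0 5*z^5 + M 0 0 6*z^6)
      + (6*M 5 1 0 + (30*M 4 1 1 - 3)*z + 60*M 3 1 2*z^2 + 60*M 2 1 3*z^3 + 30*M 1 1 4*z^4 + 6*M 0 1 5*z^5 + 0*z^6)*y
      + (15*M 4 2 0 + 60*M 3 2 1*z + (90*M 2 2 2 - 3)*z^2 + 60*M 1 2 3*z^3 + 15*M 0 2 4*z^4 + 0*z^5 + 0*z^6)*y^2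
      + (20*M 3 3 0 + 60*M 2 3 1*z + 60*M 1 3 2*z^2 + (20*M 0 3 3-1)*z^3 + 0*z^4 + 0*z^5 + 0*z^6)*y^3
      + (15*M 2 4 0 + 30*M 1 4 1*z + 15*M 0 4 2*z^2 + 0*z^3 + 0*z^4 + 0*z^5 + 0*z^6)*y^4
      + (6*M 1 5 0 + 6*M 0 5 1*z + 0*z^2 + 0*z^3 + 0*z^4 + 0*z^5 + 0*z^6)*y^5
      + (M 0 6 0 + 0*z + 0*z^2 + 0*z^3 + 0*z^4 + 0*z^5 + 0*z^6)*y^6 = 0 := by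
    intro z y
    have e : ∑ i, c i * (a i + b i * y + d i * z)^6 =
        (M 6 0 0 + 6*M 5 0 1*z + 15*M 4 0 2*z^2 + 20*M 3 0 3*z^3 + 15*M 2 0 4*z^4 + 6*M 1 0 5*z^5 + M 0 0 6*z^6)
      + (6*M 5 1 0 + 30*M 4 1 1*z + 60*M 3 1 2*z^2 + 60*M 2 1 3*z^3 + 30*M 1 1 4*z^4 + 6*M 0 1 5*z^5)*y
      + (15*M 4 2 0 + 60*M 3 2 1*z + 90*M 2 2 2*z^2 + 60*M 1 2 3*z^3 + 15*M 0 2 4*z^4)*y^2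
      + (20*M 3 3 0 + 60*M 2 3 1*z + 60*M 1 3 2*z^2 + 20*M 0 3 3*z^3)*y^3
      + (15*M 2 4 0 + 30*M 1 4 1*z + 15*M 0 4 2*z^2)*y^4
      + (6*M 1 5 0 + 6*M 0 5 1*z)*y^5
      + M 0 6 0*y^6 := by
      simp only [hM, Finset.mul_sum, Finset.sum_mul, ← Finset.sum_add_distrib]
      refine Finset.sum_congr rfl fun i _ => ?_
      ring
    have := h y z
    rw [e] at this
    linear_combination -this
  have step := fun z => aux_seven _ _ _ _ _ _ _ (key z)
  have q0 := aux_seven _ _ _ _ _ _ _ (fun z => (step z).1)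
  have q1 := aux_seven _ _ _ _ _ _ _ (fun z => (step z).2.1)
  have q2 := aux_seven _ _ _ _ _ _ _ (fun z => (step z).2.2.1)
  have q3 := aux_seven _ _ _ _ _ _ _ (fun z => (step z).2.2.2.1)
  have q4 := aux_seven _ _ _ _ _ _ _ (fun z => (step z).2.2.2.2.1)
  have q5 := aux_seven _ _ _ _ _ _ _ (fun z => (step z).2.2.2.2.2.1)
  have q6 := aux_seven _ _ _ _ _ _ _ (fun z => (step z).2.2.2.2.2.2)
  clear step key h hM
  refine ⟨?_, ?_, ?_, ?_, ?_, ?_, ?_⟩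
  · obtain ⟨h0, h1, h2, h3, h4, h5, h6⟩ := q0
    refine ⟨?_, ?_, ?_, ?_, ?_, ?_, ?_⟩ <;> grind
  · obtain ⟨h0, h1, h2, h3, h4, h5, h6⟩ := q1
    refine ⟨?_, ?_, ?_, ?_, ?_, ?_⟩ <;> grind
  · obtain ⟨h0, h1, h2, h3, h4, h5, h6⟩ := q2
    refine ⟨?_, ?_, ?_, ?_, ?_⟩ <;> grind
  · obtain ⟨h0, h1, h2, h3, h4, h5, h6⟩ := q3
    refine ⟨?_, ?_, ?_, ?_⟩ <;> grind
  · obtain ⟨h0, h1, h2, h3, h4, h5, h6⟩ := q4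
    refine ⟨?_, ?_, ?_⟩ <;> grind
  · obtain ⟨h0, h1, h2, h3, h4, h5, h6⟩ := q5
    refine ⟨?_, ?_⟩ <;> grind
  · exact q6.1

noncomputable def Vm (a b d : Fin 10 → ℂ) : Matrix (Fin 10) (Fin 10) ℂ := Matrix.of fun n =>
  ![a n ^3 * b n^0*d n^0, a n^1 * b n^1 * d n^1, a n^2*b n^1*d n^0, a n^0*b n^2*d n^1, a n^2*b n^0*d n^1, a n^0*b n^1*d n^2,
    a n^1*b n^2*d n^0, a n^1*b n^0*d n^2, a n^0*b n^3*d n^0, a n^0*b n^0*d n^3]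

lemma gram (a b d c : Fin 10 → ℂ)
    (h : ∀ y z : ℂ, (1 + y*z)^3 = ∑ i, c i * (a i + b i * y + d i * z)^6) :
    (Vm a b d).transpose * (Matrix.diagonal c * Vm a b d) = Hm := by
  obtain ⟨M, hM⟩ : ∃ M : ℕ → ℕ → ℕ → ℂ, ∀ i j k, M i j k = ∑ n, c n * (a n ^ i * b n ^ j * d n ^ k) := ⟨_, fun _ _ _ => rfl⟩
  have mm := moments a b d c h M hM
  have e : ∀ i j k i' j' k', ∑ n, (a n ^ i * b n ^ j * d n ^ k) * (c n * (a n ^ i' * b n ^ j' * d n ^ k')) = M (i+i') (j+j') (k+k') := by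
    intro i j k i' j' k'
    rw [hM]
    refine Finset.sum_congr rfl fun n _ => ?_
    ring
  obtain ⟨⟨h1, h2, h3, h4, h5, h6, h7⟩, ⟨h8, h9, h10, h11, h12, h13⟩, ⟨h14, h15, h16, h17, h18⟩,
    ⟨h19, h20, h21, h22⟩, ⟨h23, h24, h25⟩, ⟨h26, h27⟩, h28⟩ := mm
  ext i j
  rw [Matrix.mul_apply]
  simp only [Matrix.diagonal_mul, Matrix.transpose_apply]
  fin_cases i <;> fin_cases j <;> refine (e _ _ _ _ _ _).trans ?_ <;>
    simp [Hm, h1, h2, h3, h4, h5, h6, h7, h8, h9, h10, h11, h12, h13, h14, h15, h16, h17, h18, h19, h20, h21, h22, h23, h24, h25, h26, h27, h28]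

lemma ortho (a b d c : Fin 10 → ℂ)
    (h : ∀ y z : ℂ, (1 + y*z)^3 = ∑ i, c i * (a i + b i * y + d i * z)^6) (i j : Fin 10) :
    c i * (5/14 * ((a i * a j + 2*(b i * d j + d i * b j)) * (7*(a i * a j + 2*(b i * d j + d i * b j))^2
     - 3 * (a i^2 + 4*b i*d i)*(a j^2+4*b j*d j)))) = if i = j then 1 else 0 := by
  have h1 : (Vm a b d).transpose * (Matrix.diagonal c * Vm a b d * Hi) = 1 := by
    rw [← Matrix.mul_assoc, gram a b d c h, Hm_mul_Hi]
  rw [mul_eq_one_comm, Matrix.mul_assoc, Matrix.mul_assoc] at h1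
  have h2 := congrFun (congrFun h1 i) j
  rw [Matrix.diagonal_mul, Matrix.one_apply] at h2
  rw [← h2]
  congr 1
  simp [Matrix.mul_apply, Matrix.vecMul, dotProduct, Vm, Hi, Fin.sum_univ_succ]
  ring

lemma lower_bound (a b d c : Fin 10 → ℂ)
    (h : ∀ y z : ℂ, (1 + y*z)^3 = ∑ i, c i * (a i + b i * y + d i * z)^6) : False := by
  have ho := ortho a b d c h
  choose r hr using fun i => IsAlgClosed.exists_pow_nat_eq (a i^2 + 4*b i*d i) (n := 2) (by norm_num)
  obtain ⟨s, hs⟩ : ∃ s : ℂ, s^2 = 3/7 := IsAlgClosed.exists_pow_nat_eq _ (by norm_num)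
  have hr0 : ∀ i, r i ≠ 0 := by
    intro i hi
    have h1 := ho i i
    have h2 := hr i
    rw [hi] at h2
    have h3 : a i * a i + 2*(b i * d i + d i * b i) = 0 := by linear_combination -h2
    rw [h3] at h1
    simp at h1
  have hc0 : ∀ i, c i ≠ 0 := by
    intro i hi
    have h1 := ho i i
    simp [hi] at h1
  have hS : ∀ i j, ∃ e : ℤ, i ≠ j → a i * a j + 2*(b i * d j + d i * b j) = r i * r j * (s * e) := by
    intro i j
    by_cases hij : i = j
    · exact ⟨0, fun hne => absurd hij hne⟩
    have h1 := ho i j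
    rw [if_neg hij, ← hr i, ← hr j] at h1
    generalize a i * a j + 2*(b i * d j + d i * b j) = u at *
    have h2 : u * ((u - r i * r j * s) * (u + r i * r j * s)) = 0 := by
      have h3 : u * (7*u^2 - 3*r i^2*r j^2) = 0 := by
        have := (mul_eq_zero.1 h1).resolve_left (hc0 i)
        linear_combination (14/5) * this
      linear_combination h3 / 7 - u * r i^2 * r j^2 * hs
    rcases mul_eq_zero.1 h2 with h3 | h3
    · exact ⟨0, fun _ => by simp [h3]⟩
    rcases mul_eq_zero.1 h3 with h4 | h4
    · exact ⟨1, fun _ => by push_cast; linear_combination h4⟩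
    · exact ⟨-1, fun _ => by push_cast; linear_combination h4⟩
  choose S hS using hS
  obtain ⟨v, hv0, hv⟩ : ∃ v : Fin 10 → ℂ, v ≠ 0 ∧
      (Matrix.of ![a, b, d] : Matrix (Fin 3) (Fin 10) ℂ).mulVec v = 0 := by
    have hk := LinearMap.ker_ne_bot_of_finrank_lt
      (f := (Matrix.of ![a, b, d] : Matrix (Fin 3) (Fin 10) ℂ).mulVecLin) (by simp)
    obtain ⟨v, hv, hv0⟩ := Submodule.exists_mem_ne_zero_of_ne_bot hk
    exact ⟨v, hv0, by simpa using hv⟩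
  have va : ∑ j, a j * v j = 0 := congrFun hv 0
  have vb : ∑ j, b j * v j = 0 := congrFun hv 1
  have vd : ∑ j, d j * v j = 0 := congrFun hv 2
  refine int_contra (Matrix.of fun i j => if i = j then 0 else S i j) s hs (fun j => r j * v j) ?_ ?_
  · intro hw
    apply hv0
    ext j
    exact (mul_eq_zero.1 (congrFun hw j)).resolve_left (hr0 j)
  · intro i
    apply mul_left_cancel₀ (hr0 i)
    have hz : ∑ j, (a i * a j + 2*(b i * d j + d i * b j)) * v j = 0 := by
      have : ∑ j, (a i * a j + 2*(b i * d j + d i * b j)) * v j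
          = a i * ∑ j, a j * v j + 2 * (b i * ∑ j, d j * v j + d i * ∑ j, b j * v j) := by
        simp only [Finset.mul_sum, ← Finset.sum_add_distrib]
        refine Finset.sum_congr rfl fun j _ => ?_
        ring
      rw [this, va, vb, vd]; ring
    rw [mul_zero, ← hz, mul_add, Finset.mul_sum, Finset.mul_sum,
      ← Finset.add_sum_erase _ _ (Finset.mem_univ i),
      ← Finset.add_sum_erase (a := i) (f := fun j => (a i * a j + 2*(b i * d j + d i * b j)) * v j) _ (Finset.mem_univ i)]
    have he : ∀ j ∈ Finset.univ.erase i,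
        r i * (s * (((Matrix.of fun i j => if i = j then (0:ℤ) else S i j) i j : ℤ) * (r j * v j)))
        = (a i * a j + 2*(b i * d j + d i * b j)) * v j := by
      intro j hj
      have hne : i ≠ j := (Finset.ne_of_mem_erase hj).symm
      rw [hS i j hne, Matrix.of_apply, if_neg hne]
      ring
    rw [Finset.sum_congr rfl he]
    simp only [Matrix.of_apply, if_true, Int.cast_zero]
    linear_combination v i * hr i

/-- The Waring rank of `(x_0^2 + x_1x_2)^3` is exactly 11: it is a linear combination
of 11 sixth powers of homogeneous linear forms, but not of 10. -/
theorem statement7 :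
    (∃ (l : Fin 11 → MvPolynomial (Fin 3) ℂ) (c : Fin 11 → ℂ),
        (∀ i, (l i).IsHomogeneous 1) ∧
        (X 0 ^ 2 + X 1 * X 2 : MvPolynomial (Fin 3) ℂ) ^ 3
          = ∑ i, C (c i) * l i ^ 6) ∧
    ¬ (∃ (l : Fin 10 → MvPolynomial (Fin 3) ℂ) (c : Fin 10 → ℂ),
        (∀ i, (l i).IsHomogeneous 1) ∧
        (X 0 ^ 2 + X 1 * X 2 : MvPolynomial (Fin 3) ℂ) ^ 3
          = ∑ i, C (c i) * l i ^ 6) := by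
  refine ⟨upper_bound, ?_⟩
  rintro ⟨l, c, hl, h⟩
  choose a b d habd using fun i => linear_form (l i) (hl i)
  refine lower_bound a b d c fun y z => ?_
  have h1 := congrArg (MvPolynomial.eval ![1, y, z]) h
  simpa [habd] using h1
end
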